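/- Let D be a finite distributive lattice whose greatest element is join-irreducible, and suppose that exactly one element d of D lies outside J⁺(D) (i.e., d is the unique element of D that is neither ⊥, nor ⊤, nor join-irreducible). Then D has a unique proper candidate, namely Q = D \ {d} = J⁺(D), and this candidate is principal congruence representable. -/

import Mathlib

/-- A congruence of a lattice: an equivalence relation compatible with `⊔` and `⊓`. -/
structure LatCon (L : Type*) [Lattice L] where
  r : L → L → Prop
  refl : ∀ a, r a a
  symm : ∀ {a b}, r a b → r b a
  trans : ∀ {a b c}, r a b → r b c → r a c
  sup_comp : ∀ {a b c d}, r a b → r c d → r (a ⊔ c) (b ⊔ d)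
  inf_comp : ∀ {a b c d}, r a b → r c d → r (a ⊓ c) (b ⊓ d)

namespace LatCon

variable {L : Type*} [Lattice L]

theorem ext' {θ ψ : LatCon L} (h : ∀ a b, θ.r a b ↔ ψ.r a b) : θ = ψ := by
  cases θ; cases ψ
  simp only [mk.injEq]
  funext a b
  exact propext (h a b)

/-- Congruences are ordered by containment. -/
instance : PartialOrder (LatCon L) where
  le θ ψ := ∀ a b, θ.r a b → ψ.r a b
  le_refl θ := fun _ _ h => h
  le_trans θ ψ χ h1 h2 := fun a b h => h2 a b (h1 a b h)
  le_antisymm θ ψ h1 h2 := ext' fun a b => ⟨h1 a b, h2 a b⟩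

instance : InfSet (LatCon L) where
  sInf S :=
    { r := fun a b => ∀ θ ∈ S, θ.r a b
      refl := fun a θ _ => θ.refl a
      symm := fun h θ hθ => θ.symm (h θ hθ)
      trans := fun h1 h2 θ hθ => θ.trans (h1 θ hθ) (h2 θ hθ)
      sup_comp := fun h1 h2 θ hθ => θ.sup_comp (h1 θ hθ) (h2 θ hθ)
      inf_comp := fun h1 h2 θ hθ => θ.inf_comp (h1 θ hθ) (h2 θ hθ) }

/-- `Con L`, the lattice of congruences of `L`, is a complete lattice. -/
instance : CompleteLattice (LatCon L) :=
  completeLatticeOfInf (LatCon L) fun S =>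
    ⟨fun θ hθ a b h => h θ hθ, fun ψ hψ a b h θ hθ => hψ hθ a b h⟩

/-- The principal congruence `con(a, b)`: the smallest congruence collapsing `a` and `b`. -/
def princ (a b : L) : LatCon L := sInf {θ : LatCon L | θ.r a b}

/-- A congruence is principal if it is of the form `con(a, b)`. -/
def IsPrincipal (θ : LatCon L) : Prop := ∃ a b : L, θ = princ a b

end LatCon

/-- `Princ L`, the set of principal congruences of a lattice `L`,
ordered by containment (the order inherited from `Con L`). -/
def Princ (L : Type*) [Lattice L] : Set (LatCon L) := {θ : LatCon L | θ.IsPrincipal}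

/-- `J⁺(D) = {⊥, ⊤} ∪ J(D)`, where `J(D)` is the set of join-irreducible elements. -/
def Jplus (D : Type*) [Lattice D] [BoundedOrder D] : Set D :=
  {⊥, ⊤} ∪ {x : D | SupIrred x}

/-- `Q ⊆ D` is principal congruence representable: there are a finite lattice `L` and
an order isomorphism `φ : Con L ≃o D` mapping `Princ L` exactly onto `Q`. -/
def Representable (D : Type*) [Lattice D] (Q : Set D) : Prop :=
  ∃ (L : Type) (_ : Lattice L) (_ : Fintype L) (φ : LatCon L ≃o D),
    φ '' Princ L = Q

/-- `D` is fully representable: every candidate `J⁺(D) ⊆ Q ⊆ D` is representable. -/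
def FullyRepresentable (D : Type*) [Lattice D] [BoundedOrder D] : Prop :=
  ∀ Q : Set D, Jplus D ⊆ Q → Representable D Q

universe u

namespace LatCon

variable {L : Type*} [Lattice L]

theorem princ_rel (a b : L) : (princ a b).r a b := fun _ h => h

theorem princ_le_iff {a b : L} {θ : LatCon L} : princ a b ≤ θ ↔ θ.r a b :=
  ⟨fun h => h a b (princ_rel a b), fun h _ _ hxy => hxy θ h⟩

theorem le_iff {θ ψ : LatCon L} : θ ≤ ψ ↔ ∀ a b, θ.r a b → ψ.r a b := Iff.rfl

theorem bot_rel {a b : L} : (⊥ : LatCon L).r a b ↔ a = b := by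
  constructor
  · intro h
    let δ : LatCon L :=
      { r := (· = ·)
        refl := fun _ => rfl
        symm := Eq.symm
        trans := Eq.trans
        sup_comp := by rintro _ _ _ _ rfl rfl; rfl
        inf_comp := by rintro _ _ _ _ rfl rfl; rfl }
    exact (bot_le : ⊥ ≤ δ) a b h
  · rintro rfl
    exact LatCon.refl _ a

theorem top_rel (a b : L) : (⊤ : LatCon L).r a b := by
  let τ : LatCon L :=
    { r := fun _ _ => True
      refl := fun _ => trivial
      symm := id
      trans := fun _ _ => trivial
      sup_comp := fun _ _ => trivial
      inf_comp := fun _ _ => trivial }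
  exact (le_top : τ ≤ ⊤) a b trivial

theorem isPrincipal_bot [Nonempty L] : (⊥ : LatCon L).IsPrincipal := by
  obtain ⟨x⟩ := ‹Nonempty L›
  exact ⟨x, x, (bot_le.antisymm (princ_le_iff.2 (LatCon.refl _ x)))⟩

theorem isPrincipal_of_supIrred [Finite L] {θ : LatCon L} (h : SupIrred θ) : θ.IsPrincipal := by
  classical
  have := Fintype.ofFinite L
  have key : (Finset.univ.filter fun x : L × L => θ.r x.1 x.2).sup
      (fun x => princ x.1 x.2) = θ := by
    apply le_antisymm
    · exact Finset.sup_le fun x hx => princ_le_iff.2 (Finset.mem_filter.1 hx).2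
    · intro a b hab
      exact Finset.le_sup (f := fun x : L × L => princ x.1 x.2)
        (Finset.mem_filter.2 ⟨Finset.mem_univ (a, b), hab⟩) a b (princ_rel a b)
  obtain ⟨x, -, hx⟩ := h.finset_sup_eq key
  exact ⟨x.1, x.2, hx.symm⟩

theorem inf_rel_sup {θ : LatCon L} {a b : L} (h : θ.r a b) : θ.r (a ⊓ b) (a ⊔ b) := by
  have h1 := θ.inf_comp h (θ.refl b)
  have h2 := θ.sup_comp h (θ.refl b)
  rw [inf_idem] at h1
  rw [sup_idem] at h2
  exact θ.trans h1 (θ.symm h2)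

theorem rel_of_inf_rel_sup {θ : LatCon L} {a b : L} (h : θ.r (a ⊓ b) (a ⊔ b)) : θ.r a b := by
  have h1 := θ.inf_comp h (θ.refl a)
  have h2 := θ.inf_comp h (θ.refl b)
  rw [inf_eq_left.2 (inf_le_left : a ⊓ b ≤ a), inf_eq_right.2 (le_sup_left : a ≤ a ⊔ b)] at h1
  rw [inf_eq_left.2 (inf_le_right : a ⊓ b ≤ b), inf_eq_right.2 (le_sup_right : b ≤ a ⊔ b)] at h2
  exact θ.trans (θ.symm h1) h2

theorem rel_of_bot_rel_top [BoundedOrder L] {θ : LatCon L} (h : θ.r ⊥ ⊤) (a b : L) :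
    θ.r a b := by
  have key (x : L) : θ.r ⊥ x := by simpa using θ.inf_comp h (θ.refl x)
  exact θ.trans (θ.symm (key a)) (key b)

end LatCon

/-- The lattice obtained from `F` by replacing every element of the interval `[p, q]`
by a copy of `M`. -/
@[ext]
structure Inflation {F : Type*} [Lattice F] (p q : F) (M : Type*) [Lattice M]
    [BoundedOrder M] where
  base : F
  fiber : M
  fiber_eq_bot : base ∉ Set.Icc p q → fiber = ⊥

namespace Inflation

variable {F : Type*} [Lattice F] {p q : F} {M : Type*} [Lattice M] [BoundedOrder M]

open Classical in
/-- The element over `f` with fiber `m`, where `m` is forgotten outside the interval. -/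
noncomputable def mk' (f : F) (m : M) : Inflation p q M :=
  ⟨f, if f ∈ Set.Icc p q then m else ⊥, fun h => if_neg h⟩

open Classical in
/-- The fiber, read as `⊤` outside the interval. -/
noncomputable def upper (x : Inflation p q M) : M := if x.base ∈ Set.Icc p q then x.fiber else ⊤

@[simp] theorem mk'_base (f : F) (m : M) : (mk' f m : Inflation p q M).base = f := rfl

theorem mk'_fiber {f : F} (h : f ∈ Set.Icc p q) (m : M) :
    (mk' f m : Inflation p q M).fiber = m := if_pos h

theorem upper_of_mem {x : Inflation p q M} (h : x.base ∈ Set.Icc p q) : x.upper = x.fiber :=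
  if_pos h

theorem upper_of_notMem {x : Inflation p q M} (h : x.base ∉ Set.Icc p q) : x.upper = ⊤ :=
  if_neg h

theorem mk'_base_fiber (x : Inflation p q M) : mk' x.base x.fiber = x := by
  by_cases h : x.base ∈ Set.Icc p q
  · exact Inflation.ext rfl (mk'_fiber h _)
  · exact Inflation.ext rfl ((if_neg h).trans (x.fiber_eq_bot h).symm)

theorem eq_of_base_eq {x y : Inflation p q M} (h : x.base = y.base)
    (hx : x.base ∉ Set.Icc p q) : x = y :=
  Inflation.ext h (by rw [x.fiber_eq_bot hx, y.fiber_eq_bot (h ▸ hx)])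

noncomputable instance : Lattice (Inflation p q M) where
  le x y := x.base ≤ y.base ∧ (x.base ∈ Set.Icc p q → y.base ∈ Set.Icc p q → x.fiber ≤ y.fiber)
  le_refl x := ⟨le_rfl, fun _ _ => le_rfl⟩
  le_trans x y z h1 h2 := ⟨h1.1.trans h2.1, fun hx hz =>
    have hy : y.base ∈ Set.Icc p q := ⟨hx.1.trans h1.1, h2.1.trans hz.2⟩
    (h1.2 hx hy).trans (h2.2 hy hz)⟩
  le_antisymm x y h1 h2 := by
    have h := le_antisymm h1.1 h2.1
    by_cases hx : x.base ∈ Set.Icc p q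
    · exact Inflation.ext h (le_antisymm (h1.2 hx (h ▸ hx)) (h2.2 (h ▸ hx) hx))
    · exact eq_of_base_eq h hx
  sup x y := mk' (x.base ⊔ y.base) (x.fiber ⊔ y.fiber)
  inf x y := mk' (x.base ⊓ y.base) (x.upper ⊓ y.upper)
  le_sup_left x y := ⟨le_sup_left, fun _ h => by rw [mk'_fiber (f := x.base ⊔ y.base) h]; exact le_sup_left⟩
  le_sup_right x y := ⟨le_sup_right, fun _ h => by rw [mk'_fiber (f := x.base ⊔ y.base) h]; exact le_sup_right⟩
  sup_le x y z hx hy := by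
    refine ⟨sup_le hx.1 hy.1, fun h hz => ?_⟩
    rw [mk'_fiber (f := x.base ⊔ y.base) h]
    refine sup_le ?_ ?_
    · by_cases h' : x.base ∈ Set.Icc p q
      · exact hx.2 h' hz
      · rw [x.fiber_eq_bot h']; exact bot_le
    · by_cases h' : y.base ∈ Set.Icc p q
      · exact hy.2 h' hz
      · rw [y.fiber_eq_bot h']; exact bot_le
  inf_le_left x y := ⟨inf_le_left, fun h h' => by
    rw [mk'_fiber (f := x.base ⊓ y.base) h, upper_of_mem h']; exact inf_le_left⟩
  inf_le_right x y := ⟨inf_le_right, fun h h' => by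
    rw [mk'_fiber (f := x.base ⊓ y.base) h, upper_of_mem h']; exact inf_le_right⟩
  le_inf x y z hy hz := by
    refine ⟨le_inf hy.1 hz.1, fun hx h => ?_⟩
    rw [mk'_fiber (f := y.base ⊓ z.base) h]
    refine le_inf ?_ ?_
    · by_cases h' : y.base ∈ Set.Icc p q
      · rw [upper_of_mem h']; exact hy.2 hx h'
      · rw [upper_of_notMem h']; exact le_top
    · by_cases h' : z.base ∈ Set.Icc p q
      · rw [upper_of_mem h']; exact hz.2 hx h'
      · rw [upper_of_notMem h']; exact le_top

theorem sup_def (x y : Inflation p q M) :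
    x ⊔ y = mk' (x.base ⊔ y.base) (x.fiber ⊔ y.fiber) := rfl

theorem inf_def (x y : Inflation p q M) :
    x ⊓ y = mk' (x.base ⊓ y.base) (x.upper ⊓ y.upper) := rfl

@[simp] theorem base_sup (x y : Inflation p q M) : (x ⊔ y).base = x.base ⊔ y.base := rfl

@[simp] theorem base_inf (x y : Inflation p q M) : (x ⊓ y).base = x.base ⊓ y.base := rfl

instance [Finite F] [Finite M] : Finite (Inflation p q M) :=
  Finite.of_injective (fun x : Inflation p q M => (x.base, x.fiber)) fun x y h =>
    Inflation.ext (congrArg Prod.fst h) (congrArg Prod.snd h)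

variable (p q M) in
/-- The preimage of a congruence of `F` under the projection to `F`. -/
def pullback (ψ : LatCon F) : LatCon (Inflation p q M) where
  r x y := ψ.r x.base y.base
  refl _ := ψ.refl _
  symm := ψ.symm
  trans := ψ.trans
  sup_comp := ψ.sup_comp
  inf_comp := ψ.inf_comp

variable (p q) in
/-- The congruence acting as a congruence of `M` on each copy of `M`. -/
def extend (θ : LatCon M) : LatCon (Inflation p q M) where
  r x y := x.base = y.base ∧ θ.r x.fiber y.fiber
  refl _ := ⟨rfl, θ.refl _⟩
  symm h := ⟨h.1.symm, θ.symm h.2⟩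
  trans h1 h2 := ⟨h1.1.trans h2.1, θ.trans h1.2 h2.2⟩
  sup_comp {a b c d} h1 h2 := by
    refine ⟨congrArg₂ _ h1.1 h2.1, ?_⟩
    rw [sup_def, sup_def, h1.1, h2.1]
    unfold mk'
    dsimp only
    split_ifs
    · exact θ.sup_comp h1.2 h2.2
    · exact θ.refl _
  inf_comp {a b c d} h1 h2 := by
    have key {x y : Inflation p q M} (h : x.base = y.base ∧ θ.r x.fiber y.fiber) :
        θ.r x.upper y.upper := by
      unfold upper
      rw [h.1]
      split_ifs
      · exact h.2
      · exact θ.refl _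
    refine ⟨congrArg₂ _ h1.1 h2.1, ?_⟩
    rw [inf_def, inf_def, h1.1, h2.1]
    unfold mk'
    dsimp only
    split_ifs
    · exact θ.inf_comp (key h1) (key h2)
    · exact θ.refl _

theorem mk'_sup_mk' {f g : F} (hf : f ∈ Set.Icc p q) (hg : g ∈ Set.Icc p q) (m n : M) :
    (mk' f m : Inflation p q M) ⊔ mk' g n = mk' (f ⊔ g) (m ⊔ n) := by
  rw [sup_def, mk'_fiber hf, mk'_fiber hg]; rfl

theorem mk'_inf_mk' {f g : F} (hf : f ∈ Set.Icc p q) (hg : g ∈ Set.Icc p q) (m n : M) :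
    (mk' f m : Inflation p q M) ⊓ mk' g n = mk' (f ⊓ g) (m ⊓ n) := by
  rw [inf_def, upper_of_mem (by exact hf), upper_of_mem (by exact hg), mk'_fiber hf, mk'_fiber hg]
  rfl

theorem rel_transport {ρ : LatCon (Inflation p q M)} {f g : F} (hf : f ∈ Set.Icc p q)
    (hg : g ∈ Set.Icc p q) {m n : M} (h : ρ.r (mk' f m) (mk' f n)) :
    ρ.r (mk' g m) (mk' g n) := by
  have hfg : f ⊔ g ∈ Set.Icc p q := ⟨hf.1.trans le_sup_left, sup_le hf.2 hg.2⟩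
  have h1 := ρ.inf_comp (ρ.sup_comp h (ρ.refl (mk' g ⊥))) (ρ.refl (mk' g ⊤))
  simpa [mk'_sup_mk' hf hg, mk'_inf_mk' hfg hg] using h1

/-- The restriction of a congruence to the copy of `M` over `p`. -/
noncomputable def restrict (hpq : p ≤ q) (ρ : LatCon (Inflation p q M)) : LatCon M where
  r m n := ρ.r (mk' p m) (mk' p n)
  refl _ := ρ.refl _
  symm := ρ.symm
  trans := ρ.trans
  sup_comp h1 h2 := by
    have hp : p ∈ Set.Icc p q := Set.left_mem_Icc.2 hpq
    simpa [mk'_sup_mk' hp hp] using ρ.sup_comp h1 h2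
  inf_comp h1 h2 := by
    have hp : p ∈ Set.Icc p q := Set.left_mem_Icc.2 hpq
    simpa [mk'_inf_mk' hp hp] using ρ.inf_comp h1 h2

/-- The image in `F` of a congruence containing the kernel of the projection to `F`. -/
noncomputable def push (ρ : LatCon (Inflation p q M)) (h : pullback p q M ⊥ ≤ ρ) : LatCon F where
  r f g := ρ.r (mk' f ⊥) (mk' g ⊥)
  refl _ := ρ.refl _
  symm := ρ.symm
  trans := ρ.trans
  sup_comp {a b c d} h1 h2 := by
    have key (x : Inflation p q M) : ρ.r (mk' x.base ⊥) x := h _ _ (LatCon.bot_rel.2 rfl)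
    exact ρ.trans (key (mk' a ⊥ ⊔ mk' c ⊥)) (ρ.trans (ρ.sup_comp h1 h2) (ρ.symm (key (mk' b ⊥ ⊔ mk' d ⊥))))
  inf_comp {a b c d} h1 h2 := by
    have key (x : Inflation p q M) : ρ.r (mk' x.base ⊥) x := h _ _ (LatCon.bot_rel.2 rfl)
    exact ρ.trans (key (mk' a ⊥ ⊓ mk' c ⊥)) (ρ.trans (ρ.inf_comp h1 h2) (ρ.symm (key (mk' b ⊥ ⊓ mk' d ⊥))))

theorem push_rel {ρ : LatCon (Inflation p q M)} (h : pullback p q M ⊥ ≤ ρ)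
    {x y : Inflation p q M} : (push ρ h).r x.base y.base ↔ ρ.r x y := by
  have key (z : Inflation p q M) : ρ.r (mk' z.base ⊥) z := h _ _ (LatCon.bot_rel.2 rfl)
  exact ⟨fun h' => ρ.trans (ρ.symm (key x)) (ρ.trans h' (key y)),
    fun h' => ρ.trans (key x) (ρ.trans h' (ρ.symm (key y)))⟩

theorem push_le_push {ρ σ : LatCon (Inflation p q M)} (hρ : pullback p q M ⊥ ≤ ρ)
    (hσ : pullback p q M ⊥ ≤ σ) : push ρ hρ ≤ push σ hσ ↔ ρ ≤ σ :=
  ⟨fun h _ _ hxy => (push_rel hσ).1 (h _ _ ((push_rel hρ).2 hxy)), fun h _ _ hfg => h _ _ hfg⟩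

theorem kernel_le_pullback (ψ : LatCon F) : pullback p q M ⊥ ≤ pullback p q M ψ := fun _ _ h =>
  (bot_le : ⊥ ≤ ψ) _ _ h

theorem push_pullback (ψ : LatCon F) :
    push (pullback p q M ψ) (kernel_le_pullback ψ) = ψ :=
  LatCon.ext' fun _ _ => Iff.rfl

theorem restrict_extend (hpq : p ≤ q) (θ : LatCon M) : restrict hpq (extend p q θ) = θ :=
  LatCon.ext' fun m n => by
    have hp : p ∈ Set.Icc p q := Set.left_mem_Icc.2 hpq
    simp [restrict, extend, mk'_fiber hp]

theorem kernel_le_of_rel {ρ : LatCon (Inflation p q M)} {f : F} (hf : f ∈ Set.Icc p q)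
    (h : ρ.r (mk' f ⊥) (mk' f ⊤)) : pullback p q M ⊥ ≤ ρ := by
  intro x y hxy
  have hxy : x.base = y.base := LatCon.bot_rel.1 hxy
  by_cases hx : x.base ∈ Set.Icc p q
  · have hk := rel_transport hf hx h
    have key (m : M) : ρ.r (mk' x.base ⊥) (mk' x.base m) := by
      simpa [mk'_inf_mk' hx hx] using ρ.inf_comp hk (ρ.refl (mk' x.base m))
    have := ρ.trans (ρ.symm (key x.fiber)) (key y.fiber)
    rwa [mk'_base_fiber, hxy, mk'_base_fiber] at this
  · rw [eq_of_base_eq hxy hx]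
    exact ρ.refl y

theorem kernel_le_iff (hpq : p ≤ q) {ρ : LatCon (Inflation p q M)} :
    pullback p q M ⊥ ≤ ρ ↔ restrict hpq ρ = ⊤ := by
  constructor
  · intro h
    exact top_le_iff.1 fun m n _ => h _ _ (LatCon.bot_rel.2 rfl)
  · intro h
    refine kernel_le_of_rel (Set.left_mem_Icc.2 hpq) ?_
    change (restrict hpq ρ).r ⊥ ⊤
    rw [h]
    exact LatCon.top_rel _ _

theorem restrict_le_restrict (hpq : p ≤ q) {ρ σ : LatCon (Inflation p q M)}
    (hρ : ρ ≤ pullback p q M ⊥) : restrict hpq ρ ≤ restrict hpq σ ↔ ρ ≤ σ := by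
  have hp : p ∈ Set.Icc p q := Set.left_mem_Icc.2 hpq
  refine ⟨fun h x y hxy => ?_, fun h m n hmn => h _ _ hmn⟩
  have hb : x.base = y.base := LatCon.bot_rel.1 (hρ _ _ hxy)
  by_cases hx : x.base ∈ Set.Icc p q
  · have h1 : ρ.r (mk' x.base x.fiber) (mk' x.base y.fiber) := by
      rwa [mk'_base_fiber, hb, mk'_base_fiber]
    have h2 := rel_transport hp hx (h _ _ (rel_transport hx hp h1))
    rwa [mk'_base_fiber, hb, mk'_base_fiber] at h2
  · rw [eq_of_base_eq hb hx]
    exact σ.refl y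

variable (p q) in
/-- Every pair `f < g` can be translated to a pair outside `[p, q]` whose collapse forces
every copy of `M` in the inflation of `[p, q]` to collapse. -/
def Forcing : Prop :=
  ∀ f g : F, f < g → ∃ y z : F, (f ⊔ y) ⊓ z ∉ Set.Icc p q ∧ (g ⊔ y) ⊓ z ∉ Set.Icc p q ∧
    ∃ i ∈ Set.Icc p q,
      ((f ⊔ y) ⊓ z ⊔ i ∈ Set.Icc p q ∧ (g ⊔ y) ⊓ z ⊔ i ∉ Set.Icc p q) ∨
      ((g ⊔ y) ⊓ z ⊓ i ∈ Set.Icc p q ∧ (f ⊔ y) ⊓ z ⊓ i ∉ Set.Icc p q)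

theorem kernel_le_of_forcing (hF : Forcing p q) {ρ : LatCon (Inflation p q M)}
    {x y : Inflation p q M} (h : ρ.r x y) (hb : x.base ≠ y.base) : pullback p q M ⊥ ≤ ρ := by
  have hlt : x.base ⊓ y.base < x.base ⊔ y.base := inf_lt_sup.2 hb
  obtain ⟨u, v, hu, hv, i, hi, hc⟩ := hF _ _ hlt
  set a : Inflation p q M := (x ⊓ y ⊔ mk' u ⊥) ⊓ mk' v ⊥ with ha
  set b : Inflation p q M := (x ⊔ y ⊔ mk' u ⊥) ⊓ mk' v ⊥ with hb'
  have hab : ρ.r a b :=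
    ρ.inf_comp (ρ.sup_comp (LatCon.inf_rel_sup h) (ρ.refl _)) (ρ.refl _)
  have hle : a ≤ b :=
    inf_le_inf_right _ (sup_le_sup_right (inf_le_left.trans le_sup_left) _)
  change a.base ∉ _ at hu
  change b.base ∉ _ at hv
  change (a.base ⊔ i ∈ _ ∧ b.base ⊔ i ∉ _) ∨ (b.base ⊓ i ∈ _ ∧ a.base ⊓ i ∉ _) at hc
  clear_value a b
  have hle' : a.base ≤ b.base := hle.1
  rcases hc with ⟨h1, h2⟩ | ⟨h1, h2⟩
  · refine kernel_le_of_rel h1 ?_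
    have h3 := ρ.inf_comp (ρ.sup_comp hab (ρ.refl (mk' i ⊥))) (ρ.refl (mk' (a.base ⊔ i) ⊤))
    have e1 : a ⊔ mk' i ⊥ = mk' (a.base ⊔ i) ⊥ := by
      rw [sup_def, mk'_fiber hi, a.fiber_eq_bot hu, sup_idem]; rfl
    have e2 : (b ⊔ mk' i ⊥) ⊓ mk' (a.base ⊔ i) ⊤ = mk' (a.base ⊔ i) ⊤ := by
      rw [inf_def, upper_of_notMem (by exact h2), upper_of_mem (by exact h1), mk'_fiber h1,
        inf_idem, base_sup, mk'_base, mk'_base, inf_eq_right.2 (sup_le_sup_right hle' i)]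
    rwa [e1, e2, mk'_inf_mk' h1 h1, inf_idem, bot_inf_eq] at h3
  · refine kernel_le_of_rel h1 ?_
    have h3 := ρ.sup_comp (ρ.inf_comp hab (ρ.refl (mk' i ⊤))) (ρ.refl (mk' (b.base ⊓ i) ⊥))
    have e1 : b ⊓ mk' i ⊤ = mk' (b.base ⊓ i) ⊤ := by
      rw [inf_def, upper_of_mem (x := mk' i ⊤) (by exact hi), mk'_fiber hi, upper_of_notMem hv,
        inf_idem]; rfl
    have e2 : a ⊓ mk' i ⊤ ⊔ mk' (b.base ⊓ i) ⊥ = mk' (b.base ⊓ i) ⊥ := by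
      rw [sup_def, (a ⊓ mk' i ⊤).fiber_eq_bot (by exact h2), mk'_fiber h1, sup_idem, base_inf,
        mk'_base, mk'_base, sup_eq_right.2 (inf_le_inf_right i hle')]
    rw [e1, e2, mk'_sup_mk' h1 h1, sup_idem, top_sup_eq] at h3
    exact h3

theorem le_kernel_of_not_kernel_le (hF : Forcing p q) {ρ : LatCon (Inflation p q M)}
    (h : ¬ pullback p q M ⊥ ≤ ρ) : ρ ≤ pullback p q M ⊥ := fun _ _ hxy =>
  LatCon.bot_rel.2 (by_contra fun hb => h (kernel_le_of_forcing hF hxy hb))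

theorem push_princ {x y : Inflation p q M} (h : pullback p q M ⊥ ≤ LatCon.princ x y) :
    push (LatCon.princ x y) h = LatCon.princ x.base y.base := by
  apply le_antisymm
  · rw [← push_pullback (p := p) (q := q) (M := M) (LatCon.princ x.base y.base), push_le_push]
    exact LatCon.princ_le_iff.2 (LatCon.princ_rel x.base y.base)
  · exact LatCon.princ_le_iff.2 ((push_rel h).2 (LatCon.princ_rel x y))

theorem restrict_princ (hpq : p ≤ q) {x y : Inflation p q M}
    (h : LatCon.princ x y ≤ pullback p q M ⊥) :
    restrict hpq (LatCon.princ x y) = LatCon.princ x.fiber y.fiber := by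
  have hb : x.base = y.base :=
    LatCon.bot_rel.1 (LatCon.princ_le_iff (θ := pullback p q M ⊥).1 h)
  apply le_antisymm
  · rw [← restrict_extend hpq (LatCon.princ x.fiber y.fiber), restrict_le_restrict hpq h]
    exact LatCon.princ_le_iff.2 ⟨hb, LatCon.princ_rel x.fiber y.fiber⟩
  · refine LatCon.princ_le_iff.2 ?_
    by_cases hx : x.base ∈ Set.Icc p q
    · refine rel_transport (ρ := LatCon.princ x y) hx (Set.left_mem_Icc.2 hpq) ?_
      rw [mk'_base_fiber, hb, mk'_base_fiber]
      exact LatCon.princ_rel x y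
    · rw [eq_of_base_eq hb hx]
      exact LatCon.refl _ _

open Classical in
/-- The congruence lattice of an inflation is that of `F` stacked on top of that of `M`. -/
theorem exists_embedding {D : Type*} [PartialOrder D] {e d : D} {R : Set D}
    (hpq : p ≤ q) (hF : Forcing p q) (gM : LatCon M ↪o D) (gF : LatCon F ↪o D)
    (hM : Set.range gM = Set.Iic e) (hR : Set.range gF = R) (heR : IsLeast R e)
    (hMd : ∀ m n, gM (LatCon.princ m n) ≠ d) (hFd : ∀ f g, gF (LatCon.princ f g) ≠ d) :
    ∃ g : LatCon (Inflation p q M) ↪o D, Set.range g = Set.Iic e ∪ R ∧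
      ∀ x y, g (LatCon.princ x y) ≠ d := by
  have hMle (θ) : gM θ ≤ e := hM.subset (Set.mem_range_self θ)
  have hFle (ψ) : e ≤ gF ψ := heR.2 (hR.subset (Set.mem_range_self ψ))
  have hMtop : gM ⊤ = e := by
    obtain ⟨θ, hθ⟩ := hM.superset (Set.self_mem_Iic (a := e))
    exact (hMle _).antisymm (hθ ▸ gM.monotone le_top)
  have hFbot : gF ⊥ = e := by
    obtain ⟨ψ, hψ⟩ := hR.superset heR.1
    exact (hψ ▸ gF.monotone bot_le : gF ⊥ ≤ e).antisymm (hFle _)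
  let g (ρ : LatCon (Inflation p q M)) : D :=
    if h : pullback p q M ⊥ ≤ ρ then gF (push ρ h) else gM (restrict hpq ρ)
  have gpos {ρ} (h : pullback p q M ⊥ ≤ ρ) : g ρ = gF (push ρ h) := dif_pos h
  have gneg {ρ} (h : ¬ pullback p q M ⊥ ≤ ρ) : g ρ = gM (restrict hpq ρ) := dif_neg h
  have hg (ρ σ) : g ρ ≤ g σ ↔ ρ ≤ σ := by
    by_cases hρ : pullback p q M ⊥ ≤ ρ <;> by_cases hσ : pullback p q M ⊥ ≤ σ
    · rw [gpos hρ, gpos hσ, gF.le_iff_le, push_le_push]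
    · rw [gpos hρ, gneg hσ]
      refine ⟨fun h => absurd ((kernel_le_iff hpq).2 ?_) hσ, fun h => absurd (hρ.trans h) hσ⟩
      exact gM.injective (((hMle _).antisymm ((hFle _).trans h)).trans hMtop.symm)
    · rw [gneg hρ, gpos hσ]
      exact iff_of_true ((hMle _).trans (hFle _)) ((le_kernel_of_not_kernel_le hF hρ).trans hσ)
    · rw [gneg hρ, gneg hσ, gM.le_iff_le,
        restrict_le_restrict hpq (le_kernel_of_not_kernel_le hF hρ)]
  refine ⟨OrderEmbedding.ofMapLEIff g hg, ?_, fun x y => ?_⟩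
  · apply Set.Subset.antisymm
    · rintro _ ⟨ρ, rfl⟩
      change g ρ ∈ _
      by_cases hρ : pullback p q M ⊥ ≤ ρ
      · rw [gpos hρ, ← hR]
        exact Or.inr (Set.mem_range_self _)
      · rw [gneg hρ]
        exact Or.inl (hMle _)
    · have hsub : R ⊆ Set.range g := by
        rw [← hR]
        rintro _ ⟨ψ, rfl⟩
        exact ⟨pullback p q M ψ, by rw [gpos (kernel_le_pullback ψ), push_pullback]⟩
      refine Set.union_subset (fun c hc => ?_) hsub
      obtain ⟨θ, rfl⟩ := hM.superset hc
      by_cases hθ : θ = ⊤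
      · subst hθ
        rw [hMtop]
        exact hsub heR.1
      · refine ⟨extend p q θ, (gneg ?_).trans (by rw [restrict_extend])⟩
        rwa [kernel_le_iff hpq, restrict_extend]
  · change g _ ≠ d
    by_cases h : pullback p q M ⊥ ≤ LatCon.princ x y
    · rw [gpos h, push_princ]
      exact hFd _ _
    · rw [gneg h, restrict_princ hpq (le_kernel_of_not_kernel_le hF h)]
      exact hMd _ _

end Inflation

/-- The congruence given by the fibers of a compatible map. -/
def LatCon.ofMap {L : Type*} [Lattice L] (κ : L → L)
    (hsup : ∀ x y, κ (x ⊔ y) = κ (κ x ⊔ κ y)) (hinf : ∀ x y, κ (x ⊓ y) = κ (κ x ⊓ κ y)) :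
    LatCon L where
  r x y := κ x = κ y
  refl _ := rfl
  symm := Eq.symm
  trans := Eq.trans
  sup_comp {a b c d} h1 h2 := by rw [hsup, h1, h2, ← hsup]
  inf_comp {a b c d} h1 h2 := by rw [hinf, h1, h2, ← hinf]

/-- The five-element modular lattice with three atoms `x`, `u`, `v`. -/
inductive Diamond
  | bot | top | x | u | v
  deriving DecidableEq

namespace Diamond

instance : Fintype Diamond := ⟨{bot, top, x, u, v}, fun a => by cases a <;> decide⟩

instance : Lattice Diamond :=
  letI : Max Diamond := ⟨fun
    | bot, b => b
    | a, bot => a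
    | a, b => if a = b then a else top⟩
  letI : Min Diamond := ⟨fun
    | top, b => b
    | a, top => a
    | a, b => if a = b then a else bot⟩
  Lattice.mk' (by decide) (by decide) (by decide) (by decide) (by decide) (by decide)

instance : DecidableLE Diamond := fun a b => decEq (a ⊔ b) b

instance : DecidableLT Diamond := decidableLTOfDecidableLE

instance : BoundedOrder Diamond where
  bot := bot
  top := top
  bot_le := by decide
  le_top := by decide

theorem forcing : Inflation.Forcing x x := by
  unfold Inflation.Forcing
  decide

theorem bot_rel_top {θ : LatCon Diamond} {a b : Diamond} (h : θ.r a b) (hab : a ≠ b) :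
    θ.r ⊥ ⊤ := by
  have step : ∀ a b : Diamond, a < b →
      ∃ y z, (a ⊔ y) ⊓ z = ⊥ ∧ ∃ y' z', y' ⊓ z' = ⊥ ∧ ((b ⊔ y) ⊓ z ⊔ y') ⊓ z' = u ∧
        ∃ y' z', y' ⊓ z' = ⊥ ∧ ((b ⊔ y) ⊓ z ⊔ y') ⊓ z' = v := by
    decide
  obtain ⟨y, z, h1, y', z', h2, h3, y'', z'', h4, h5⟩ := step _ _ (inf_lt_sup.2 hab)
  have h6 := θ.inf_comp (θ.sup_comp (LatCon.inf_rel_sup h) (θ.refl y)) (θ.refl z)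
  have h7 := θ.inf_comp (θ.sup_comp h6 (θ.refl y')) (θ.refl z')
  have h8 := θ.inf_comp (θ.sup_comp h6 (θ.refl y'')) (θ.refl z'')
  rw [h1, bot_sup_eq, h2, h3] at h7
  rw [h1, bot_sup_eq, h4, h5] at h8
  exact θ.sup_comp h7 h8

open Classical in
theorem exists_embedding {D : Type*} [PartialOrder D] {e z : D} (hez : e < z) :
    ∃ g : LatCon Diamond ↪o D, Set.range g = {e, z} := by
  let g (θ : LatCon Diamond) : D := if θ.r ⊥ ⊤ then z else e
  have hbot {θ : LatCon Diamond} (h : ¬ θ.r ⊥ ⊤) (ψ) : θ ≤ ψ := fun a b hab => by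
    by_cases hne : a = b
    · exact hne ▸ ψ.refl a
    · exact absurd (bot_rel_top hab hne) h
  have hg (θ ψ) : g θ ≤ g ψ ↔ θ ≤ ψ := by
    by_cases h1 : θ.r ⊥ ⊤ <;> by_cases h2 : ψ.r ⊥ ⊤ <;> simp only [g, h1, h2, if_true, if_false]
    · exact iff_of_true le_rfl fun a b _ => LatCon.rel_of_bot_rel_top h2 a b
    · exact iff_of_false hez.not_ge fun h => h2 (h _ _ h1)
    · exact iff_of_true hez.le (hbot h1 ψ)
    · exact iff_of_true le_rfl (hbot h1 ψ)
  refine ⟨OrderEmbedding.ofMapLEIff g hg, Set.Subset.antisymm ?_ ?_⟩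
  · rintro _ ⟨θ, rfl⟩
    by_cases h : θ.r ⊥ ⊤
    · exact Or.inr (if_pos h)
    · exact Or.inl (if_neg h)
  · rintro _ (rfl | rfl)
    · exact ⟨⊥, if_neg (by rw [LatCon.bot_rel]; decide)⟩
    · exact ⟨⊤, if_pos (LatCon.top_rel _ _)⟩

end Diamond

/-- An eleven-element lattice: besides the bounds and a common complement `w` of all other
elements, it consists of two squares `r < s, q < q₁` and `p₀ < p, r₁ < s₁`
linked by `p < q`. -/
inductive TwinSquares
  | bot | top | w | r | s | p₀ | p | q | q₁ | r₁ | s₁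
  deriving DecidableEq

namespace TwinSquares

instance : Fintype TwinSquares :=
  ⟨{bot, top, w, r, s, p₀, p, q, q₁, r₁, s₁}, fun a => by cases a <;> decide⟩

/-- The order of `TwinSquares`. -/
def leBool : TwinSquares → TwinSquares → Bool
  | bot, _ | _, top => true
  | r, s | r, q | r, q₁ | s, q₁ => true
  | p₀, p | p₀, q | p₀, q₁ | p₀, r₁ | p₀, s₁ => true
  | p, q | p, q₁ | p, s₁ | q, q₁ | r₁, s₁ => true
  | a, b => a == b

/-- The join of incomparable elements of `TwinSquares`. -/
def supAux : TwinSquares → TwinSquares → TwinSquares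
  | r, p₀ | p₀, r | r, p | p, r => q
  | s, p₀ | p₀, s | s, p | p, s | s, q | q, s => q₁
  | p, r₁ | r₁, p => s₁
  | _, _ => top

/-- The meet of incomparable elements of `TwinSquares`. -/
def infAux : TwinSquares → TwinSquares → TwinSquares
  | s₁, q₁ | q₁, s₁ | s₁, q | q, s₁ => p
  | r₁, q₁ | q₁, r₁ | r₁, q | q, r₁ | r₁, p | p, r₁ => p₀
  | q, s | s, q => r
  | _, _ => bot

instance : Lattice TwinSquares :=
  letI : Max TwinSquares :=
    ⟨fun a b => if leBool a b then b else if leBool b a then a else supAux a b⟩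
  letI : Min TwinSquares :=
    ⟨fun a b => if leBool a b then a else if leBool b a then b else infAux a b⟩
  Lattice.mk' (by decide) (by decide +kernel) (by decide) (by decide +kernel) (by decide)
    (by decide)

instance : DecidableLE TwinSquares := fun a b => decEq (a ⊔ b) b

instance : DecidableLT TwinSquares := decidableLTOfDecidableLE

instance : BoundedOrder TwinSquares where
  bot := bot
  top := top
  bot_le := by decide
  le_top := by decide

theorem forcing : Inflation.Forcing p q := by
  unfold Inflation.Forcing
  decide +kernel

/-- The map identifying `r` with `s` and `q` with `q₁`. -/
def lowerMap : TwinSquares → TwinSquares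
  | s => r
  | q₁ => q
  | a => a

/-- The map identifying `p₀` with `p` and `r₁` with `s₁`. -/
def upperMap : TwinSquares → TwinSquares
  | p => p₀
  | s₁ => r₁
  | a => a

/-- The congruence collapsing `r` with `s` and `q` with `q₁`. -/
def lowerCon : LatCon TwinSquares :=
  LatCon.ofMap lowerMap (by decide +kernel) (by decide +kernel)

/-- The congruence collapsing `p₀` with `p` and `r₁` with `s₁`. -/
def upperCon : LatCon TwinSquares :=
  LatCon.ofMap upperMap (by decide +kernel) (by decide +kernel)

instance : DecidableRel lowerCon.r := fun a b => decEq (lowerMap a) (lowerMap b)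

instance : DecidableRel upperCon.r := fun a b => decEq (upperMap a) (upperMap b)

theorem bot_rel_top_of_bot_rel {θ : LatCon TwinSquares} {a : TwinSquares} (h : θ.r ⊥ a)
    (ha : a ≠ ⊥) : θ.r ⊥ ⊤ := by
  have step : ∀ a : TwinSquares, a ≠ ⊥ → (∃ y z, y ⊓ z = ⊥ ∧ (a ⊔ y) ⊓ z = s) ∧
      ∃ y z, y ⊓ z = ⊥ ∧ (a ⊔ y) ⊓ z = s₁ := by
    decide +kernel
  obtain ⟨⟨y, z, h1, h2⟩, y', z', h3, h4⟩ := step a ha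
  have h5 := θ.inf_comp (θ.sup_comp h (θ.refl y)) (θ.refl z)
  have h6 := θ.inf_comp (θ.sup_comp h (θ.refl y')) (θ.refl z')
  rw [bot_sup_eq, h1, h2] at h5
  rw [bot_sup_eq, h3, h4] at h6
  exact θ.sup_comp h5 h6

theorem rel_cases {θ : LatCon TwinSquares} {a b : TwinSquares} (h : θ.r a b) :
    θ.r ⊥ ⊤ ∨ a = b ∨ (θ.r r s ∧ lowerCon.r a b) ∨ (θ.r p₀ p ∧ upperCon.r a b) := by
  have step : ∀ a b : TwinSquares, a < b →
      (∃ y z, (a ⊔ y) ⊓ z = ⊥ ∧ (b ⊔ y) ⊓ z ≠ ⊥) ∨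
        (a ⊓ s = r ∧ b ⊓ s = s ∧ lowerCon.r a b) ∨
        ((a ⊔ r₁) ⊓ q = p₀ ∧ (b ⊔ r₁) ⊓ q = p ∧ upperCon.r a b) := by
    decide +kernel
  by_cases hab : a = b
  · exact Or.inr (Or.inl hab)
  have h' := LatCon.inf_rel_sup h
  rcases step _ _ (inf_lt_sup.2 hab) with ⟨y, z, h1, h2⟩ | ⟨h1, h2, h3⟩ | ⟨h1, h2, h3⟩
  · have h3 := θ.inf_comp (θ.sup_comp h' (θ.refl y)) (θ.refl z)
    rw [h1] at h3
    exact Or.inl (bot_rel_top_of_bot_rel h3 h2)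
  · have h4 := θ.inf_comp h' (θ.refl s)
    rw [h1, h2] at h4
    exact Or.inr (Or.inr (Or.inl ⟨h4, LatCon.rel_of_inf_rel_sup h3⟩))
  · have h4 := θ.inf_comp (θ.sup_comp h' (θ.refl r₁)) (θ.refl q)
    rw [h1, h2] at h4
    exact Or.inr (Or.inr (Or.inr ⟨h4, LatCon.rel_of_inf_rel_sup h3⟩))

theorem lowerCon_le_iff {θ : LatCon TwinSquares} : lowerCon ≤ θ ↔ θ.r r s := by
  refine ⟨fun h => h r s (by decide), fun h a b hab => ?_⟩
  have step : ∀ a b : TwinSquares, lowerCon.r a b → a < b →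
      ∃ y, r ⊔ y = a ∧ s ⊔ y = b := by
    decide +kernel
  by_cases hne : a = b
  · exact hne ▸ θ.refl a
  obtain ⟨y, h1, h2⟩ := step _ _ (LatCon.inf_rel_sup hab) (inf_lt_sup.2 hne)
  have h3 := θ.sup_comp h (θ.refl y)
  rw [h1, h2] at h3
  exact LatCon.rel_of_inf_rel_sup h3

theorem upperCon_le_iff {θ : LatCon TwinSquares} : upperCon ≤ θ ↔ θ.r p₀ p := by
  refine ⟨fun h => h p₀ p (by decide), fun h a b hab => ?_⟩
  have step : ∀ a b : TwinSquares, upperCon.r a b → a < b →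
      ∃ y, p₀ ⊔ y = a ∧ p ⊔ y = b := by
    decide +kernel
  by_cases hne : a = b
  · exact hne ▸ θ.refl a
  obtain ⟨y, h1, h2⟩ := step _ _ (LatCon.inf_rel_sup hab) (inf_lt_sup.2 hne)
  have h3 := θ.sup_comp h (θ.refl y)
  rw [h1, h2] at h3
  exact LatCon.rel_of_inf_rel_sup h3

theorem le_iff {θ ψ : LatCon TwinSquares} :
    θ ≤ ψ ↔ (θ.r ⊥ ⊤ → ψ.r ⊥ ⊤) ∧ (θ.r r s → ψ.r r s) ∧ (θ.r p₀ p → ψ.r p₀ p) := by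
  refine ⟨fun h => ⟨h _ _, h _ _, h _ _⟩, fun ⟨h1, h2, h3⟩ a b hab => ?_⟩
  rcases rel_cases hab with h | rfl | ⟨h, hc⟩ | ⟨h, hc⟩
  · exact LatCon.rel_of_bot_rel_top (h1 h) a b
  · exact ψ.refl a
  · exact lowerCon_le_iff.2 (h2 h) a b hc
  · exact upperCon_le_iff.2 (h3 h) a b hc

/-- The join of `lowerCon` and `upperCon`. -/
def middleCon : LatCon TwinSquares :=
  LatCon.ofMap (fun a => upperMap (lowerMap a)) (by decide +kernel) (by decide +kernel)

instance : DecidableRel middleCon.r := fun a b =>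
  decEq (upperMap (lowerMap a)) (upperMap (lowerMap b))

open Classical in
/-- The congruence lattice of `TwinSquares` is the four-element Boolean lattice with a new
greatest element, and its unique coatom is not principal. -/
theorem exists_embedding {D : Type*} [Lattice D] {a b z : D} (hab : ¬ a ≤ b) (hba : ¬ b ≤ a)
    (hz : a ⊔ b < z) :
    ∃ g : LatCon TwinSquares ↪o D, Set.range g = {a ⊓ b, a, b, a ⊔ b, z} ∧
      ∀ x y, g (LatCon.princ x y) ≠ a ⊔ b := by
  let k (θ : LatCon TwinSquares) : D :=
    (if θ.r r s then a else a ⊓ b) ⊔ (if θ.r p₀ p then b else a ⊓ b)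
  let g (θ : LatCon TwinSquares) : D := if θ.r ⊥ ⊤ then z else k θ
  have hk (θ) : k θ ≤ a ⊔ b := by
    refine sup_le_sup ?_ ?_ <;> split_ifs
    exacts [le_rfl, inf_le_left, le_rfl, inf_le_right]
  have hka (θ) : a ≤ k θ ↔ θ.r r s := by
    refine ⟨fun h => by_contra fun h' => hab (h.trans (sup_le ?_ ?_)),
      fun h => (if_pos h).ge.trans le_sup_left⟩
    · rw [if_neg h']
      exact inf_le_right
    · split_ifs
      exacts [le_rfl, inf_le_right]
  have hkb (θ) : b ≤ k θ ↔ θ.r p₀ p := by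
    refine ⟨fun h => by_contra fun h' => hba (h.trans (sup_le ?_ ?_)),
      fun h => (if_pos h).ge.trans le_sup_right⟩
    · split_ifs
      exacts [le_rfl, inf_le_left]
    · rw [if_neg h']
      exact inf_le_left
  have hinf (θ) : a ⊓ b ≤ k θ := by
    refine le_sup_of_le_left ?_
    split_ifs
    exacts [inf_le_left, le_rfl]
  have hg (θ ψ) : g θ ≤ g ψ ↔ θ ≤ ψ := by
    by_cases h1 : ψ.r ⊥ ⊤
    · refine iff_of_true ?_ fun x y _ => LatCon.rel_of_bot_rel_top h1 x y
      simp only [g, if_pos h1]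
      split_ifs
      exacts [le_rfl, (hk θ).trans hz.le]
    · by_cases h2 : θ.r ⊥ ⊤
      · simp only [g, if_neg h1, if_pos h2]
        exact iff_of_false (fun h => hz.not_ge (h.trans (hk ψ))) fun h => h1 (h _ _ h2)
      · simp only [g, if_neg h1, if_neg h2, le_iff]
        refine ⟨fun h => ⟨fun h' => absurd h' h2, fun h' => ?_, fun h' => ?_⟩,
          fun ⟨_, h3, h4⟩ => sup_le ?_ ?_⟩
        · exact (hka ψ).1 (((hka θ).2 h').trans h)
        · exact (hkb ψ).1 (((hkb θ).2 h').trans h)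
        · split_ifs with h
          exacts [(hka ψ).2 (h3 h), hinf ψ]
        · split_ifs with h
          exacts [(hkb ψ).2 (h4 h), hinf ψ]
  refine ⟨OrderEmbedding.ofMapLEIff g hg, Set.Subset.antisymm ?_ ?_, fun x y hxy => ?_⟩
  · rintro _ ⟨θ, rfl⟩
    change g θ ∈ _
    by_cases h1 : θ.r ⊥ ⊤ <;> by_cases h2 : θ.r r s <;> by_cases h3 : θ.r p₀ p <;>
      simp [g, k, h1, h2, h3]
  · rintro _ (rfl | rfl | rfl | rfl | rfl)
    · refine ⟨⊥, ?_⟩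
      simp [g, k, LatCon.bot_rel, show (⊥ : TwinSquares) ≠ ⊤ by decide]
    · refine ⟨lowerCon, ?_⟩
      simp [g, k, show ¬ lowerCon.r ⊥ ⊤ by decide, show lowerCon.r r s by decide,
        show ¬ lowerCon.r p₀ p by decide]
    · refine ⟨upperCon, ?_⟩
      simp [g, k, show ¬ upperCon.r ⊥ ⊤ by decide, show upperCon.r p₀ p by decide,
        show ¬ upperCon.r r s by decide]
    · refine ⟨middleCon, ?_⟩
      simp [g, k, show ¬ middleCon.r ⊥ ⊤ by decide, show middleCon.r p₀ p by decide,
        show middleCon.r r s by decide]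
    · exact ⟨⊤, if_pos (LatCon.top_rel _ _)⟩
  · have h1 : ¬ (LatCon.princ x y).r ⊥ ⊤ := fun h => hz.ne (hxy.symm.trans (if_pos h))
    have hxy : k (LatCon.princ x y) = a ⊔ b := (if_neg h1).symm.trans hxy
    have hr := (hka _).1 (le_sup_left.trans hxy.ge)
    have hp := (hkb _).1 (le_sup_right.trans hxy.ge)
    rcases rel_cases (LatCon.princ_rel x y) with h | rfl | ⟨-, h⟩ | ⟨-, h⟩
    · exact h1 h
    · exact absurd (LatCon.bot_rel.1 (LatCon.princ_le_iff.2 (LatCon.refl ⊥ x) _ _ hr)) (by decide)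
    · exact absurd (LatCon.princ_le_iff.2 h _ _ hp) (by decide)
    · exact absurd (LatCon.princ_le_iff.2 h _ _ hr) (by decide)

end TwinSquares

/-- There is a finite lattice whose congruence lattice is isomorphic to `Set.Iic z`, such that
no principal congruence corresponds to `d`. -/
def OmitsPrincipal {D : Type*} [PartialOrder D] (d z : D) : Prop :=
  ∃ (L : Type) (_ : Lattice L) (_ : Finite L) (_ : Nonempty L) (g : LatCon L ↪o D),
    Set.range g = Set.Iic z ∧ ∀ x y, g (LatCon.princ x y) ≠ d

theorem OmitsPrincipal.inflate {D : Type*} [PartialOrder D] {d e z : D} {R : Set D}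
    (h : OmitsPrincipal d e) {F : Type} [Lattice F] [Finite F] {p q : F} (hpq : p ≤ q)
    (hF : Inflation.Forcing p q) (gF : LatCon F ↪o D) (hR : Set.range gF = R)
    (hFd : ∀ x y, gF (LatCon.princ x y) ≠ d) (heR : IsLeast R e) (hz : Set.Iic e ∪ R = Set.Iic z) :
    OmitsPrincipal d z := by
  obtain ⟨M, _, _, _, gM, hM, hMd⟩ := h
  have := Fintype.ofFinite M
  let _ : BoundedOrder M := Fintype.toBoundedOrder M
  obtain ⟨g, hg, hgd⟩ := Inflation.exists_embedding hpq hF gM gF hM hR heR hMd hFd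
  exact ⟨Inflation p q M, inferInstance, inferInstance, ⟨⟨p, ⊥, fun _ => rfl⟩⟩, g, hg.trans hz, hgd⟩

theorem omitsPrincipal_bot {D : Type*} [PartialOrder D] [OrderBot D] {d : D} (hd : d ≠ ⊥) :
    OmitsPrincipal d (⊥ : D) := by
  have hs (θ ψ : LatCon Unit) : θ = ψ := LatCon.ext' fun a b => iff_of_true (θ.refl a) (ψ.refl a)
  let g : LatCon Unit ↪o D := OrderEmbedding.ofMapLEIff (fun _ => ⊥) fun θ ψ =>
    iff_of_true le_rfl (hs θ ψ).le
  refine ⟨Unit, inferInstance, inferInstance, inferInstance, g, ?_, fun _ _ => hd.symm⟩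
  rw [Set.Iic_bot]
  exact Set.range_const

theorem SupIrred.le_of_lt_of_covBy {D : Type*} [Lattice D] {c w z : D} (hz : SupIrred z)
    (hc : c ⋖ z) (hw : w < z) : w ≤ c := by
  rcases hc.eq_or_eq (c := c ⊔ w) le_sup_left (sup_le hc.le hw.le) with h | h
  · exact sup_eq_left.1 h
  · exact ((hz.2 h).elim hc.ne hw.ne).elim

theorem OmitsPrincipal.of_covBy {D : Type*} [Lattice D] {c d z : D} (h : OmitsPrincipal d c)
    (hz : SupIrred z) (hc : c ⋖ z) (hcd : c ≠ d) (hzd : z ≠ d) : OmitsPrincipal d z := by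
  obtain ⟨g, hg⟩ := Diamond.exists_embedding hc.lt
  refine h.inflate le_rfl Diamond.forcing g hg (fun x y hxy => ?_)
    ⟨Or.inl rfl, ?_⟩ (Set.Subset.antisymm ?_ ?_)
  · rcases hg.subset (Set.mem_range_self (LatCon.princ x y)) with h | h
    · exact hcd (h.symm.trans hxy)
    · exact hzd (h.symm.trans hxy)
  · rintro _ (rfl | rfl)
    exacts [le_rfl, hc.le]
  · rintro w (hw | rfl | rfl)
    exacts [le_trans hw hc.le, hc.le, le_rfl]
  · intro w hw
    rcases eq_or_lt_of_le (Set.mem_Iic.1 hw) with rfl | hw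
    · exact Or.inr (Or.inr rfl)
    · exact Or.inl (hz.le_of_lt_of_covBy hc hw)

section UniqueReducible

variable {D : Type*} [DistribLattice D] [BoundedOrder D] {a b : D}

theorem eq_or_le_inf_of_le_sup (hab : ¬ a ≤ b) (hba : ¬ b ≤ a)
    (hirr : ∀ x : D, x ≠ a ⊔ b → x = ⊥ ∨ SupIrred x) {w : D} (hw : w ≤ a ⊔ b) :
    w ≤ a ⊓ b ∨ w = a ∨ w = b ∨ w = a ⊔ b := by
  have key {a b : D} (hab : ¬ a ≤ b) (hba : ¬ b ≤ a)
      (hirr : ∀ x : D, x ≠ a ⊔ b → x = ⊥ ∨ SupIrred x) {w : D} (hw : w ≤ a) :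
      w ≤ a ⊓ b ∨ w = a := by
    by_cases h : w ⊔ b = a ⊔ b
    · have ha : SupIrred a := (hirr a fun h => hba (le_sup_right.trans h.ge)).resolve_left
        fun h => hab (h ▸ bot_le)
      have h2 : w ⊔ a ⊓ b = a := by
        rw [sup_inf_left, h, sup_eq_right.2 hw, inf_eq_left.2 le_sup_left]
      rcases ha.2 h2 with h | h
      · exact Or.inr h
      · exact absurd (inf_eq_left.1 h) hab
    · left
      refine le_inf hw ?_
      rcases hirr _ h with h | h
      · exact le_sup_left.trans (h.le.trans bot_le)
      · rcases h.2 rfl with h | h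
        · exact absurd ((le_sup_right.trans h.ge).trans hw) hba
        · exact le_sup_left.trans h.ge
  by_cases h : w = a ⊔ b
  · exact Or.inr (Or.inr (Or.inr h))
  have hw' : w ≤ a ∨ w ≤ b := by
    rcases hirr w h with rfl | h
    · exact Or.inl bot_le
    · have := h.2 (show w ⊓ a ⊔ w ⊓ b = w by rw [← inf_sup_left, inf_eq_left.2 hw])
      exact this.imp inf_eq_left.1 inf_eq_left.1
  rcases hw' with h | h
  · exact (key hab hba hirr h).imp_right Or.inl
  · rw [sup_comm] at hirr
    rw [inf_comm]
    exact (key hba hab hirr h).imp_right fun h => Or.inr (Or.inl h)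

theorem OmitsPrincipal.of_sup_covBy (hab : ¬ a ≤ b) (hba : ¬ b ≤ a)
    (hirr : ∀ x : D, x ≠ a ⊔ b → x = ⊥ ∨ SupIrred x) {z : D} (hz : SupIrred z)
    (hc : a ⊔ b ⋖ z) (h : OmitsPrincipal (a ⊔ b) (a ⊓ b)) : OmitsPrincipal (a ⊔ b) z := by
  obtain ⟨g, hg, hgd⟩ := TwinSquares.exists_embedding hab hba hc.lt
  have haz : a ≤ z := le_sup_left.trans hc.le
  have hbz : b ≤ z := le_sup_right.trans hc.le
  refine h.inflate (by decide) TwinSquares.forcing g hg hgd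
    ⟨Or.inl rfl, ?_⟩ (Set.Subset.antisymm ?_ ?_)
  · rintro _ (rfl | rfl | rfl | rfl | rfl)
    exacts [le_rfl, inf_le_left, inf_le_right, inf_le_left.trans le_sup_left,
      inf_le_left.trans haz]
  · rintro w (hw | rfl | rfl | rfl | rfl | rfl)
    exacts [le_trans hw (inf_le_left.trans haz), inf_le_left.trans haz, haz, hbz, hc.le, le_rfl]
  · intro w hw
    rcases eq_or_lt_of_le (Set.mem_Iic.1 hw) with rfl | hw
    · simp
    · rcases eq_or_le_inf_of_le_sup hab hba hirr (hz.le_of_lt_of_covBy hc hw) with h | h | h | h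
      · exact Or.inl h
      all_goals simp [h]

theorem omitsPrincipal_top [Finite D] (hab : ¬ a ≤ b) (hba : ¬ b ≤ a)
    (hirr : ∀ x : D, x ≠ a ⊔ b → x = ⊥ ∨ SupIrred x) (htop : a ⊔ b ≠ ⊤) :
    OmitsPrincipal (a ⊔ b) (⊤ : D) := by
  have hbot : a ⊔ b ≠ ⊥ := fun h => hab ((le_sup_left.trans h.le).trans bot_le)
  have hlow : ∀ z : D, z ≤ a ⊓ b → OmitsPrincipal (a ⊔ b) z := by
    intro z
    induction z using WellFoundedLT.induction with
    | ind z ih =>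
      intro hz
      have hne {y : D} (hy : y ≤ a ⊓ b) : y ≠ a ⊔ b := fun h =>
        hab (le_sup_left.trans (h.ge.trans (hy.trans inf_le_right)))
      rcases hirr z (hne hz) with rfl | hzi
      · exact omitsPrincipal_bot hbot
      · obtain ⟨c, -, hc⟩ := exists_le_covBy_of_lt (bot_lt_iff_ne_bot.2 hzi.ne_bot)
        have hc' := hc.le.trans hz
        exact (ih c hc.lt hc').of_covBy hzi hc (hne hc') (hne hz)
  have hhigh : ∀ z : D, a ⊔ b < z → OmitsPrincipal (a ⊔ b) z := by
    intro z
    induction z using WellFoundedLT.induction with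
    | ind z ih =>
      intro hz
      have hzi := (hirr z hz.ne').resolve_left (bot_le.trans_lt hz).ne'
      obtain ⟨c, hdc, hc⟩ := exists_le_covBy_of_lt hz
      rcases eq_or_lt_of_le hdc with rfl | hdc
      · exact OmitsPrincipal.of_sup_covBy hab hba hirr hzi hc (hlow _ le_rfl)
      · exact (ih c hc.lt hdc).of_covBy hzi hc hdc.ne' hz.ne'
  exact hhigh ⊤ (lt_top_iff_ne_top.2 htop)

end UniqueReducible

theorem OmitsPrincipal.representable {D : Type*} [Lattice D] [BoundedOrder D] {d : D}
    (h : OmitsPrincipal d (⊤ : D)) (hirr : ∀ x : D, x ≠ d → x = ⊥ ∨ SupIrred x) :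
    Representable D {d}ᶜ := by
  obtain ⟨L, _, _, _, g, hg, hgd⟩ := h
  have hsurj : Function.Surjective g := by
    rw [← Set.range_eq_univ, hg, Set.Iic_top]
  let φ : LatCon L ≃o D := RelIso.ofSurjective g hsurj
  refine ⟨L, inferInstance, Fintype.ofFinite L, φ, Set.Subset.antisymm ?_ ?_⟩
  · rintro _ ⟨_, ⟨x, y, rfl⟩, rfl⟩
    exact hgd x y
  · intro x hx
    refine ⟨φ.symm x, ?_, φ.apply_symm_apply x⟩
    rcases hirr x hx with rfl | h
    · rw [OrderIso.map_bot]
      exact LatCon.isPrincipal_bot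
    · refine LatCon.isPrincipal_of_supIrred ⟨fun hmin => h.1 fun y hy => ?_, fun c e hce => ?_⟩
      · have := hmin (φ.symm.monotone hy)
        exact φ.symm.le_iff_le.1 this
      · have h1 : φ c ⊔ φ e = x := by
          rw [← OrderIso.map_sup, hce, φ.apply_symm_apply]
        exact (h.2 h1).imp (fun h => (φ.symm_apply_eq.2 h.symm).symm)
          fun h => (φ.symm_apply_eq.2 h.symm).symm

/-- **Lemma 8.** Let `D` be a finite distributive lattice whose unit is join-irreducible
and which has exactly one element `d` outside `J⁺(D)`. Then `D` has a unique proper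
candidate, namely `J⁺(D) = D \ {d}`, and it is representable. -/
theorem unique_proper_candidate_representable
    (D : Type*) [DistribLattice D] [Fintype D] [BoundedOrder D]
    (htop : SupIrred (⊤ : D)) (hd : ∃! d : D, d ∉ Jplus D) :
    (∀ d : D, d ∉ Jplus D → Jplus D = Set.univ \ {d}) ∧
    (∀ Q : Set D, Jplus D ⊆ Q → Q ≠ Set.univ → Q = Jplus D) ∧
    Representable D (Jplus D) := by
  obtain ⟨d, hd, huniq⟩ := hd
  have hJ : Jplus D = {d}ᶜ := by
    ext x
    refine ⟨fun hx h => hd (h ▸ hx), fun hx => by_contra fun h => hx (huniq x h)⟩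
  have hirr (x : D) (hx : x ≠ d) : x = ⊥ ∨ SupIrred x := by
    rcases (hJ.ge hx : x ∈ Jplus D) with (rfl | rfl) | h
    exacts [Or.inl rfl, Or.inr htop, Or.inr h]
  refine ⟨fun d' hd' => ?_, fun Q hQ hne => ?_, ?_⟩
  · rw [huniq d' hd', hJ, Set.compl_eq_univ_sdiff]
  · refine (hQ.antisymm fun x hx => ?_).symm
    by_contra hxJ
    refine hne (Set.eq_univ_of_forall fun y => ?_)
    by_cases hy : y ∈ Jplus D
    · exact hQ hy
    · rwa [huniq y hy, ← huniq x hxJ]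
  · have hdtop : d ≠ ⊤ := fun h => hd (Or.inl (Or.inr h))
    have hdbot : d ≠ ⊥ := fun h => hd (Or.inl (Or.inl h))
    rcases not_supIrred.1 fun h => hd (Or.inr h) with h | ⟨a, b, rfl, ha, hb⟩
    · exact absurd h.eq_bot hdbot
    · have hab : ¬ a ≤ b := fun h => hb.ne (sup_eq_right.2 h).symm
      have hba : ¬ b ≤ a := fun h => ha.ne (sup_eq_left.2 h).symm
      rw [hJ]
      exact (omitsPrincipal_top hab hba hirr hdtop).representable hirr
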